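/- For every k ≥ 1 and t ≥ 6: if k is even then 2(t-1)·5^{(k-2)/2} + 1 ≤ gr_k(K_3 ; S_t^2) ≤ 2t·5^{(k-2)/2}, and if k is odd then (t-1)·5^{(k-1)/2} + 1 ≤ gr_k(K_3 ; S_t^2) ≤ t·5^{(k-1)/2}. -/

import Mathlib

/-- `SGraph t r` is the graph `S_t^r`: a star `K_{1,t-1}` with center `0`
together with `r` independent edges `(1,2), (3,4), …, (2r-1,2r)` among the leaves. -/
def SGraph (t r : ℕ) : SimpleGraph (Fin t) :=
  SimpleGraph.fromRel fun a b =>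
    a.val = 0 ∨ (b.val = a.val + 1 ∧ a.val % 2 = 1 ∧ b.val ≤ 2 * r)

/-- A monochromatic copy of `H` in the edge-coloring `c` of the complete graph on `V`. -/
def HasMonoCopy {α V C : Type*} (H : SimpleGraph α) (c : Sym2 V → C) : Prop :=
  ∃ (f : α ↪ V) (col : C), ∀ a b : α, H.Adj a b → c s(f a, f b) = col

/-- A copy of `H` in the edge-coloring `c` all of whose edges get color `col`. -/
def HasMonoCopyCol {α V C : Type*} (H : SimpleGraph α) (c : Sym2 V → C) (col : C) : Prop :=
  ∃ f : α ↪ V, ∀ a b : α, H.Adj a b → c s(f a, f b) = col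

/-- A rainbow triangle in the edge-coloring `c` of the complete graph on `V`. -/
def HasRainbowTriangle {V C : Type*} (c : Sym2 V → C) : Prop :=
  ∃ x y z : V,
    c s(x, y) ≠ c s(y, z) ∧ c s(y, z) ≠ c s(x, z) ∧ c s(x, y) ≠ c s(x, z)


section Gallai

variable {V C : Type*}

/-- No triangle of the symmetric coloring `d` is rainbow. -/
def GallaiColoring (d : V → V → C) : Prop :=
  ∀ x y z, d x y = d y z ∨ d y z = d x z ∨ d x y = d x z

/-- All edges of the complete graph on `S` have a color in `K`. -/
def ColoredIn (d : V → V → C) (S : Finset V) (K : Finset C) : Prop :=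
  ∀ u ∈ S, ∀ v ∈ S, u ≠ v → d u v ∈ K

/-- The edges of color `r` inside `S`. -/
def ColorStep (d : V → V → C) (S : Finset V) (r : C) (a b : V) : Prop :=
  a ∈ S ∧ b ∈ S ∧ a ≠ b ∧ d a b = r

/-- Being joined by a path of color `r` inside `S`. -/
abbrev ColorReach (d : V → V → C) (S : Finset V) (r : C) : V → V → Prop :=
  Relation.ReflTransGen (ColorStep d S r)

theorem ColorReach.symm {d : V → V → C} (hs : ∀ u v, d u v = d v u) {S : Finset V} {r : C}
    {a b : V} (h : ColorReach d S r a b) : ColorReach d S r b a := by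
  have : Std.Symm (ColorStep d S r) :=
    ⟨fun a b ⟨h1, h2, h3, h4⟩ => ⟨h2, h1, h3.symm, by rw [hs, h4]⟩⟩
  exact (Relation.ReflTransGen.stdSymm (r := ColorStep d S r)).symm _ _ h

theorem ColorReach.mem_of_closed {d : V → V → C} {S : Finset V} {r : C} {P : V → Prop}
    (hP : ∀ a b, P a → ColorStep d S r a b → P b) {a b : V} (ha : P a)
    (h : ColorReach d S r a b) : P b := by
  induction h with
  | refl => exact ha
  | tail _ h2 ih => exact hP _ _ ih h2

/-- A vertex outside a component of color `r` sends a single color to that component. -/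
theorem GallaiColoring.eq_of_colorReach {d : V → V → C}
    (hr : GallaiColoring d) {S : Finset V} {r : C} {a b y : V} (hy : y ∈ S)
    (h : ColorReach d S r a b) (hn : ¬ ColorReach d S r a y) : d a y = d b y := by
  have key : ∀ z, z ∈ S → ColorReach d S r a z → d z y ≠ r := by
    intro z hz hz1 hz2
    by_cases e : z = y
    · exact hn (e ▸ hz1)
    · exact hn (hz1.tail ⟨hz, hy, e, hz2⟩)
  induction h with
  | refl => rfl
  | @tail b c h1 h2 ih =>
    have e1 := key b h2.1 h1
    have e2 := key c h2.2.1 (h1.tail h2)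
    have e3 := h2.2.2.2
    rcases hr b c y with h | h | h <;> grind

/-- If at least three colors occur on `S`, then one of them is disconnected. -/
theorem GallaiColoring.exists_disconnected [DecidableEq V] [Nonempty C] {d : V → V → C} (hs : ∀ u v, d u v = d v u)
    (hr : GallaiColoring d) (S : Finset V)
    (h3 : ¬ ∃ r b, ∀ u ∈ S, ∀ v ∈ S, u ≠ v → d u v = r ∨ d u v = b) :
    ∃ r, (∃ u ∈ S, ∃ v ∈ S, u ≠ v ∧ d u v = r) ∧
      ∃ u ∈ S, ∃ v ∈ S, ¬ ColorReach d S r u v := by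
  induction S using Finset.induction_on with
  | empty => exact absurd ⟨Classical.arbitrary C, Classical.arbitrary C, by simp⟩ h3
  | insert x T hx ih =>
    by_cases hT : ∃ r b, ∀ u ∈ T, ∀ v ∈ T, u ≠ v → d u v = r ∨ d u v = b
    · obtain ⟨r, b, hT⟩ := hT
      have : ∃ y ∈ T, d x y ≠ r ∧ d x y ≠ b := by
        by_contra! hc
        refine h3 ⟨r, b, fun u hu v hv huv => ?_⟩
        grind
      obtain ⟨y, hy, hy1, hy2⟩ := this
      by_cases hall : ∀ z ∈ T, d x z = d x y
      · have : ∃ u ∈ T, ∃ v ∈ T, u ≠ v := by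
          by_contra! hc
          refine h3 ⟨d x y, d x y, fun u hu v hv huv => ?_⟩
          grind
        obtain ⟨u, hu, v, hv, huv⟩ := this
        refine ⟨d u v, ⟨u, by grind, v, by grind, huv, rfl⟩, x, by grind, u, by grind, ?_⟩
        intro h
        have := ColorReach.mem_of_closed (P := fun z => z = x) ?_ rfl h
        · grind
        · rintro a c rfl ⟨h1, h2, h3, h4⟩
          have := hT u hu v hv huv
          grind
      · push Not at hall
        obtain ⟨z, hz, hzy⟩ := hall
        refine ⟨d x y, ⟨x, by grind, y, by grind, by grind, rfl⟩, z, by grind, x, by grind, ?_⟩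
        intro h
        have := ColorReach.mem_of_closed (P := fun w => w ∈ T ∧ d x w ≠ d x y) ?_ ⟨hz, hzy⟩ h
        · grind
        · rintro a c ⟨ha1, ha2⟩ ⟨h1, h2, h3, h4⟩
          grind
    · obtain ⟨r, ⟨u, hu, v, hv, huv, hc⟩, p, hp, q, hq, hpq⟩ := ih hT
      by_cases hA : ∀ w ∈ T, ∃ z ∈ T, ColorReach d T r w z ∧ d x z = r
      swap
      · push Not at hA
        obtain ⟨w, hw, hA⟩ := hA
        refine ⟨r, ⟨u, by grind, v, by grind, huv, hc⟩, w, by grind, x, by grind, fun h => ?_⟩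
        have := ColorReach.mem_of_closed (P := fun z => z ∈ T ∧ ColorReach d T r w z) ?_
          ⟨hw, .refl⟩ h
        · grind
        · rintro a c ⟨ha1, ha2⟩ ⟨h1, h2, h3, h4⟩
          have := hA a ha1 ha2
          have hcT : c ∈ T := by grind
          exact ⟨hcT, ha2.tail ⟨ha1, hcT, h3, h4⟩⟩
      have cross : ∀ y ∈ T, ∀ w ∈ T, d x y ≠ r → ¬ ColorReach d T r y w → d y w = d x y := by
        intro y hy w hw hyr hyw
        obtain ⟨z, hz, hwz, hxz⟩ := hA w hw
        have hzy : ¬ ColorReach d T r w y := fun h => hyw (h.symm hs)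
        have e1 := hr.eq_of_colorReach hy hwz hzy
        have e2 : d y z ≠ r := by
          intro e
          by_cases e' : y = z
          · exact hzy (e' ▸ hwz)
          · exact hyw ((Relation.ReflTransGen.single ⟨hy, hz, e', e⟩).trans (hwz.symm hs))
        rcases hr x y z with h | h | h <;> grind
      have same : ∀ y ∈ T, ∀ y' ∈ T, d x y ≠ r → d x y' ≠ r → d x y = d x y' := by
        intro y hy y' hy' h1 h2
        by_cases hyy : ColorReach d T r y y'
        · obtain ⟨w, hw, hyw⟩ : ∃ w ∈ T, ¬ ColorReach d T r y w := by
            by_contra! hcon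
            exact hpq (((hcon p hp).symm hs).trans (hcon q hq))
          have e1 := cross y hy w hw h1 hyw
          have e2 := cross y' hy' w hw h2 (fun h => hyw (hyy.trans h))
          have e3 := hr.eq_of_colorReach hw hyy hyw
          grind
        · have e1 := cross y hy y' hy' h1 hyy
          have e2 := cross y' hy' y hy h2 (fun h => hyy (h.symm hs))
          grind
      by_contra hcon
      push Not at hcon
      by_cases hy : ∃ y ∈ T, d x y ≠ r
      · obtain ⟨y, hy, hyr⟩ := hy
        refine h3 ⟨r, d x y, ?_⟩
        by_contra! hne
        obtain ⟨a, ha, b, hb, hab, hab1, hab2⟩ := hne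
        have h := hcon (d a b) ⟨a, ha, b, hb, hab, rfl⟩ x (by simp) y (by grind)
        have := ColorReach.mem_of_closed (P := fun z => z = x) ?_ rfl h
        · grind
        · rintro a' c rfl ⟨h1, h2, h3, h4⟩
          grind
      · push Not at hy
        refine h3 ⟨r, r, ?_⟩
        by_contra! hne
        obtain ⟨a, ha, b, hb, hab, hab1, hab2⟩ := hne
        have h := hcon (d a b) ⟨a, ha, b, hb, hab, rfl⟩ x (by simp) p (by grind)
        have := ColorReach.mem_of_closed (P := fun z => z = x) ?_ rfl h
        · grind
        · rintro a' c rfl ⟨h1, h2, h3, h4⟩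
          grind

/-- Gallai's partition theorem: `p` labels the parts, and between distinct parts there are at
most two colors, and only one between any given two parts. -/
theorem GallaiColoring.exists_partition [DecidableEq V] {d : V → V → C} (hs : ∀ u v, d u v = d v u)
    (hr : GallaiColoring d) (S : Finset V) (hS : 2 ≤ S.card) :
    ∃ (p : V → V) (r b : C), (∃ u ∈ S, ∃ v ∈ S, p u ≠ p v) ∧
      (∀ u ∈ S, ∀ v ∈ S, p u ≠ p v → d u v = r ∨ d u v = b) ∧
      ∀ u ∈ S, ∀ u' ∈ S, ∀ v ∈ S, p u = p u' → p u ≠ p v → d u v = d u' v := by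
  induction hn : S.card using Nat.strong_induction_on generalizing S with
  | _ n ih =>
  by_cases h3 : ∃ r b, ∀ u ∈ S, ∀ v ∈ S, u ≠ v → d u v = r ∨ d u v = b
  · obtain ⟨r, b, h3⟩ := h3
    obtain ⟨u, hu, v, hv, huv⟩ := Finset.one_lt_card.1 hS
    exact ⟨id, r, b, ⟨u, hu, v, hv, huv⟩, h3, by rintro u - u' - v - rfl -; rfl⟩
  have : Nonempty C := by
    obtain ⟨u, -⟩ := Finset.one_lt_card.1 hS
    exact ⟨d u u⟩
  obtain ⟨r, ⟨u, hu, v, hv, huv, huvr⟩, p, hp, q, hq, hpq⟩ := hr.exists_disconnected hs S h3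
  let st : Setoid V := ⟨ColorReach d S r, fun _ => .refl, fun h => h.symm hs, fun h => h.trans⟩
  let e : V → V := fun a => (Quotient.mk st a).out
  have he : ∀ a, ColorReach d S r a (e a) := fun a => (Quotient.mk_out (s := st) a).symm hs
  have heq : ∀ a b, ColorReach d S r a b → e a = e b := fun a b h => by
    have : Quotient.mk st a = Quotient.mk st b := Quotient.sound h
    simp only [e, this]
  have hmem : ∀ a ∈ S, e a ∈ S := fun a ha =>
    ColorReach.mem_of_closed (P := (· ∈ S)) (fun _ _ _ h => h.2.1) ha (he a)
  have hne : ∀ a b, e a ≠ e b → ¬ ColorReach d S r a b := fun a b h h' => h (heq a b h')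
  have hlt : (S.image e).card < n := by
    rw [← hn]
    refine lt_of_le_of_ne Finset.card_image_le fun h => huv ?_
    exact Finset.card_image_iff.1 h hu hv (heq u v (.single ⟨hu, hv, huv, huvr⟩))
  have hpq' : e p ≠ e q := fun h => hpq ((he p).trans (h ▸ (he q).symm hs))
  obtain ⟨P, s, s', ⟨a', ha, b', hb, hab⟩, h1, h2⟩ := ih _ hlt (S.image e)
    (Finset.one_lt_card.2 ⟨e p, Finset.mem_image_of_mem e hp, e q, Finset.mem_image_of_mem e hq,
      hpq'⟩) rfl
  have hd : ∀ a ∈ S, ∀ b ∈ S, e a ≠ e b → d a b = d (e a) (e b) := by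
    intro a ha b hb hab
    have e1 := hr.eq_of_colorReach hb (he a) (hne a b hab)
    have hb' : ¬ ColorReach d S r b (e a) := fun h =>
      hne a b hab ((he a).trans (h.symm hs))
    have e2 := hr.eq_of_colorReach (hmem a ha) (he b) hb'
    rw [e1, hs, e2, hs]
  obtain ⟨a, ha', rfl⟩ := Finset.mem_image.1 ha
  obtain ⟨b, hb', rfl⟩ := Finset.mem_image.1 hb
  refine ⟨P ∘ e, s, s', ⟨a, ha', b, hb', hab⟩, ?_, ?_⟩
  · intro u hu v hv huv
    rw [hd u hu v hv fun h => huv (congrArg P h)]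
    exact h1 _ (Finset.mem_image_of_mem e hu) _ (Finset.mem_image_of_mem e hv) huv
  · intro u hu u' hu' v hv huu huv
    rw [hd u hu v hv fun h => huv (congrArg P h),
      hd u' hu' v hv fun h => huv (huu.trans (congrArg P h))]
    exact h2 _ (Finset.mem_image_of_mem e hu) _ (Finset.mem_image_of_mem e hu') _
      (Finset.mem_image_of_mem e hv) huu huv

end Gallai

section Upper

variable {V C : Type*}

/-- No edge of color `q` lies inside `S`. -/
def ColorFree (d : V → V → C) (S : Finset V) (q : C) : Prop :=
  ∀ u ∈ S, ∀ v ∈ S, u ≠ v → d u v ≠ q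

/-- No vertex `v` has, in some color `q`, at least `t - 1` neighbors spanning two independent
edges of color `q`. -/
def StarFree (t : ℕ) (d : V → V → C) : Prop :=
  ∀ (v : V) (q : C) (N : Finset V), v ∉ N → t ≤ N.card + 1 → (∀ z ∈ N, d v z = q) →
    ∀ a ∈ N, ∀ b ∈ N, ∀ x ∈ N, ∀ y ∈ N, a ≠ b → x ≠ y → a ≠ x → a ≠ y → b ≠ x → b ≠ y →
      d a b = q → d x y ≠ q

/-- All edges between `X` and `Y` have color `q`. -/
def JoinedBy (d : V → V → C) (X Y : Finset V) (q : C) : Prop :=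
  ∀ x ∈ X, ∀ y ∈ Y, d x y = q

theorem JoinedBy.symm {d : V → V → C} (hs : ∀ u v, d u v = d v u) {X Y : Finset V} {q : C}
    (h : JoinedBy d X Y q) : JoinedBy d Y X q :=
  fun y hy x hx => (hs y x).trans (h x hx y hy)

theorem ColorFree.mono {d : V → V → C} {S T : Finset V} {q : C} (h : ColorFree d S q)
    (hT : T ⊆ S) : ColorFree d T q :=
  fun u hu v hv => h u (hT hu) v (hT hv)

theorem ColoredIn.mono {d : V → V → C} {S T : Finset V} {K : Finset C} (h : ColoredIn d S K)
    (hT : T ⊆ S) : ColoredIn d T K :=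
  fun u hu v hv => h u (hT hu) v (hT hv)

theorem ColoredIn.erase [DecidableEq C] {d : V → V → C} {S : Finset V} {K : Finset C} {q : C}
    (h : ColoredIn d S K) (hq : ColorFree d S q) : ColoredIn d S (K.erase q) :=
  fun u hu v hv huv => Finset.mem_erase.2 ⟨hq u hu v hv huv, h u hu v hv huv⟩

variable [DecidableEq V] {d : V → V → C} {t : ℕ}

/-- Two vertices cover all edges of color `q` in a large `q`-neighborhood. -/
theorem StarFree.exists_cover (hM : StarFree t d) {v : V} {q : C} {X : Finset V} (hv : v ∉ X)
    (hX : t ≤ X.card + 1) (h : ∀ z ∈ X, d v z = q) :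
    ∃ D ⊆ X, D.card ≤ 2 ∧ ColorFree d (X \ D) q := by
  by_cases hF : ColorFree d X q
  · exact ⟨∅, by simp, by simp, by simpa using hF⟩
  · unfold ColorFree at hF
    push Not at hF
    obtain ⟨a, ha, b, hb, hab, habq⟩ := hF
    refine ⟨{a, b}, by grind, Finset.card_le_two, fun x hx y hy hxy => ?_⟩
    simp only [Finset.mem_sdiff, Finset.mem_insert, Finset.mem_singleton, not_or] at hx hy
    exact hM v q X hv hX h a ha b hb x hx.1 y hy.1 hab hxy (Ne.symm hx.2.1) (Ne.symm hy.2.1)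
      (Ne.symm hx.2.2) (Ne.symm hy.2.2) habq

/-- If two large sets are joined in color `q`, an edge of color `q` inside one of them meets all
such edges inside either of them. -/
theorem StarFree.colorFree_erase (hs : ∀ u v, d u v = d v u) (hM : StarFree t d) (ht : 6 ≤ t)
    {X Y : Finset V} {q : C} (hXY : Disjoint X Y) (hX : t ≤ X.card + 1) (hY : t ≤ Y.card + 1)
    (h : JoinedBy d X Y q) {a b : V} (ha : a ∈ X) (hb : b ∈ X) (hab : a ≠ b) (habq : d a b = q) :
    ColorFree d (X.erase a) q ∧ ColorFree d Y q := by
  have hd : ∀ x ∈ X, x ∉ Y := fun x hx hy => Finset.disjoint_left.1 hXY hx hy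
  constructor
  · intro u hu v hv huv huvq
    obtain ⟨hua, hu⟩ := Finset.mem_erase.1 hu
    obtain ⟨hva, hv⟩ := Finset.mem_erase.1 hv
    obtain ⟨y, hy, y', hy', hyy⟩ := Finset.one_lt_card.1 (show 1 < Y.card by omega)
    have path : ∀ v ∈ X, v ≠ a → v ≠ b → d b v ≠ q := by
      intro v hv hva hvb hbv
      refine hM b q (insert a (insert v Y)) (by grind) ?_ ?_ a (by grind) y (by grind)
        v (by grind) y' (by grind) (by grind) (by grind) (by grind) (by grind) (by grind)
        (by grind) (h a ha y hy) (h v hv y' hy')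
      · have := Finset.card_le_card (show Y ⊆ insert a (insert v Y) by grind)
        omega
      · intro z hz
        simp only [Finset.mem_insert] at hz
        rcases hz with rfl | rfl | hz
        · rw [hs, habq]
        · exact hbv
        · exact h b hb z hz
    by_cases hub : u = b
    · exact path v hv hva (by grind) (hub ▸ huvq)
    by_cases hvb : v = b
    · exact path u hu hua hub (by rw [hs, ← hvb, huvq])
    exact hM y q X (fun hyX => hd y hyX hy) hX (fun z hz => (hs y z).trans (h z hz y hy))
      a ha b hb u hu v hv hab huv hua.symm hva.symm (Ne.symm hub) (Ne.symm hvb) habq huvq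
  · intro u hu v hv huv huvq
    obtain ⟨w, hw⟩ : (Y \ {u, v}).Nonempty := by
      rw [← Finset.card_pos]
      have := Finset.le_card_sdiff {u, v} Y
      have : ({u, v} : Finset V).card ≤ 2 := Finset.card_le_two
      omega
    simp only [Finset.mem_sdiff, Finset.mem_insert, Finset.mem_singleton, not_or] at hw
    refine hM a q (insert b Y) (by grind) ?_ ?_ b (by grind) w (by grind)
      u (by grind) v (by grind) (by grind) (by grind) (by grind) (by grind) (by grind)
      (by grind) (h b hb w hw.1) huvq
    · have := Finset.card_le_card (Finset.subset_insert b Y)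
      omega
    · intro z hz
      rcases Finset.mem_insert.1 hz with rfl | hz
      · exact habq
      · exact h a ha z hz

/-- If two large sets are joined in color `q`, one vertex covers all edges of color `q` inside
them. -/
theorem StarFree.exists_cover_joined (hs : ∀ u v, d u v = d v u) (hM : StarFree t d) (ht : 6 ≤ t)
    {X Y : Finset V} {q : C} (hXY : Disjoint X Y) (hX : t ≤ X.card + 1) (hY : t ≤ Y.card + 1)
    (h : JoinedBy d X Y q) :
    ∃ D : Finset V, D.card ≤ 1 ∧ ColorFree d (X \ D) q ∧ ColorFree d (Y \ D) q := by
  by_cases hFX : ColorFree d X q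
  · by_cases hFY : ColorFree d Y q
    · exact ⟨∅, by simp, by simpa using hFX, by simpa using hFY⟩
    · unfold ColorFree at hFY
      push Not at hFY
      obtain ⟨a, ha, b, hb, hab, habq⟩ := hFY
      have := hM.colorFree_erase hs ht hXY.symm hY hX (h.symm hs) ha hb hab habq
      exact ⟨{a}, by simp, hFX.mono Finset.sdiff_subset, by
        rw [Finset.sdiff_singleton_eq_erase]; exact this.1⟩
  · unfold ColorFree at hFX
    push Not at hFX
    obtain ⟨a, ha, b, hb, hab, habq⟩ := hFX
    have := hM.colorFree_erase hs ht hXY hX hY h ha hb hab habq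
    exact ⟨{a}, by simp, by rw [Finset.sdiff_singleton_eq_erase]; exact this.1,
      this.2.mono Finset.sdiff_subset⟩

theorem StarFree.card_add_card_lt (hs : ∀ u v, d u v = d v u) (hM : StarFree t d) (ht : 6 ≤ t)
    {X Y : Finset V} {q : C} (hXY : Disjoint X Y) (hX : X.Nonempty) (hY : Y.Nonempty)
    (h : JoinedBy d X Y q) {m : ℕ} (hm : t ≤ m)
    (hmX : ∀ S ⊆ X, ColorFree d S q → S.card < m) (hmY : ∀ S ⊆ Y, ColorFree d S q → S.card < m) :
    X.card + Y.card < 2 * m := by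
  have side : ∀ X Y : Finset V, Disjoint X Y → Y.Nonempty → JoinedBy d X Y q →
      (∀ S ⊆ X, ColorFree d S q → S.card < m) → t ≤ X.card + 1 → X.card ≤ m + 1 := by
    intro X Y hXY ⟨y, hy⟩ h hmX hX
    obtain ⟨D, -, hD, hF⟩ := hM.exists_cover (v := y) (X := X) (q := q)
      (fun hyX => Finset.disjoint_left.1 hXY hyX hy) hX
      (fun z hz => (hs y z).trans (h z hz y hy))
    have := hmX _ Finset.sdiff_subset hF
    have := Finset.le_card_sdiff D X
    omega
  by_cases h1 : t ≤ X.card + 1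
  · by_cases h2 : t ≤ Y.card + 1
    · obtain ⟨D, hD, hFX, hFY⟩ := hM.exists_cover_joined hs ht hXY h1 h2 h
      have e1 := hmX _ Finset.sdiff_subset hFX
      have e2 := hmY _ Finset.sdiff_subset hFY
      have e3 := Finset.le_card_sdiff D (X ∪ Y)
      rw [Finset.card_union_of_disjoint hXY, Finset.union_sdiff_distrib] at e3
      have e4 := Finset.card_union_le (X \ D) (Y \ D)
      omega
    · have := side X Y hXY hY h hmX h1
      omega
  · by_cases h2 : t ≤ Y.card + 1
    · have := side Y X hXY.symm hX (h.symm hs) hmY h2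
      omega
    · omega

/-- A large clique of color `q` is impossible. -/
theorem StarFree.clique_card_lt (hM : StarFree t d) (ht : 6 ≤ t) {S : Finset V} {q : C}
    (hS : ColoredIn d S {q}) : S.card < t := by
  by_contra! hc
  obtain ⟨v, hv⟩ : S.Nonempty := Finset.card_pos.1 (by omega)
  have hcard := Finset.card_erase_of_mem hv
  obtain ⟨D, -, hD, hF⟩ := hM.exists_cover (v := v) (X := S.erase v) (q := q) (by simp) (by omega)
    (fun z hz => by
      have := hS v hv z (Finset.mem_of_mem_erase hz) (Finset.ne_of_mem_erase hz).symm
      simpa using this)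
  have := Finset.le_card_sdiff D (S.erase v)
  obtain ⟨x, hx, y, hy, hxy⟩ := Finset.one_lt_card.1 (show 1 < (S.erase v \ D).card by omega)
  have h1 := hF x hx y hy hxy
  have h2 := hS x (by grind) y (by grind) hxy
  simp_all

theorem StarFree.two_colors_aux (hs : ∀ u v, d u v = d v u) (hM : StarFree t d) (ht : 6 ≤ t)
    {S : Finset V} {q q' : C} (hS : ∀ u ∈ S, ∀ v ∈ S, u ≠ v → d u v = q ∨ d u v = q')
    {v : V} {A : Finset V} (hvA : v ∉ A) (hAS : A ⊆ S) (hA : t ≤ A.card)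
    (hq : ∀ z ∈ A, d v z = q) : S.card < 2 * t := by
  have clique : ∀ T ⊆ S, ColorFree d T q → T.card < t := by
    intro T hT hF
    refine hM.clique_card_lt ht (q := q') fun u hu v hv huv => ?_
    have := hF u hu v hv huv
    have := hS u (hT hu) v (hT hv) huv
    simp_all
  by_cases hB : ∃ B ⊆ S, ColorFree d B q ∧ t ≤ B.card + 1
  · obtain ⟨B, hBS, hBF, hB⟩ := hB
    have hne : (S \ B).Nonempty ∨ S.card < 2 * t := by
      rw [← Finset.card_pos]
      have := Finset.le_card_sdiff B S
      have := clique B hBS hBF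
      omega
    rcases hne with hne | hne
    swap
    · exact hne
    have hj : JoinedBy d B (S \ B) q := by
      intro w hw u hu
      obtain ⟨huS, huB⟩ := Finset.mem_sdiff.1 hu
      by_contra hwu
      have hwq : ∀ z ∈ insert u (B.erase w), d w z = q' := by
        intro z hz
        rcases Finset.mem_insert.1 hz with rfl | hz
        · have := hS w (hBS hw) z huS (by grind)
          tauto
        · have := hS w (hBS hw) z (hBS (by grind)) (by grind)
          have := hBF w hw z (by grind) (by grind)
          tauto
      have hc1 := Finset.card_erase_of_mem hw
      have hc2 : (insert u (B.erase w)).card = (B.erase w).card + 1 :=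
        Finset.card_insert_of_notMem (by grind)
      obtain ⟨D, -, hD, hF⟩ := hM.exists_cover (v := w) (by grind) (by omega) hwq
      have := Finset.le_card_sdiff D (B.erase w)
      obtain ⟨x, hx, y, hy, hxy⟩ :=
        Finset.one_lt_card.1 (show 1 < (B.erase w \ D).card by omega)
      have h1 := hF x (by grind) y (by grind) hxy
      have h2 := hS x (hBS (by grind)) y (hBS (by grind)) hxy
      have h3 := hBF x (by grind) y (by grind) hxy
      tauto
    have := hM.card_add_card_lt hs ht Finset.disjoint_sdiff (Finset.card_pos.1 (by omega)) hne hj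
      le_rfl (fun T hT => clique T (hT.trans hBS))
      (fun T hT => clique T (hT.trans Finset.sdiff_subset))
    rwa [add_comm, Finset.card_sdiff_add_card_eq_card hBS] at this
  · exfalso
    push Not at hB
    have hAF : ¬ ColorFree d A q := fun h => by
      have := hB A hAS h
      omega
    unfold ColorFree at hAF
    push Not at hAF
    obtain ⟨a, ha, a', ha', haa, haq⟩ := hAF
    have hA' : t ≤ A.card + 1 := by omega
    have nbr : ∀ a ∈ A, ∀ a' ∈ A, a ≠ a' → d a a' = q →
        ∃ z ∈ A, z ≠ a ∧ z ≠ a' ∧ d a' z = q := by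
      intro a ha a' ha' haa haq
      by_contra! hc
      have hc1 := Finset.card_erase_of_mem ha
      have := hB (A.erase a) ((Finset.erase_subset _ _).trans hAS) (by
        intro x hx y hy hxy
        by_cases h1 : x = a'
        · subst h1
          exact hc y (by grind) (by grind) (by grind)
        by_cases h2 : y = a'
        · subst h2
          rw [hs]
          exact hc x (by grind) (by grind) (by grind)
        exact hM v q A hvA hA' hq a ha a' ha' x (by grind) y (by grind) haa hxy (by grind) (by grind)
          (by grind) (by grind) haq)
      omega
    obtain ⟨z, hz, hza, hza', hzq⟩ := nbr a ha a' ha' haa haq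
    obtain ⟨z', hz', hza1, hza1', hzq'⟩ := nbr a' ha' a ha haa.symm (by rw [hs, haq])
    have hzz : z = z' := by
      by_contra hne
      exact hM v q A hvA hA' hq a' ha' z hz a ha z' hz' hza'.symm hza1'.symm haa.symm hza1.symm hza hne hzq hzq'
    subst hzz
    have out : ∀ w ∈ A, w ≠ a → w ≠ a' → w ≠ z → ∀ u ∈ A, u ≠ w → d w u = q' := by
      intro w hw h1 h2 h3 u hu huw
      have h5 : d w u ≠ q := by
        by_cases hu1 : u = a
        · subst hu1
          exact hM v q A hvA hA' hq a' ha' z hz w hw u hu hza'.symm huw.symm h2.symm haa.symm h3.symm hza hzq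
        by_cases hu2 : u = a'
        · subst hu2
          exact hM v q A hvA hA' hq a ha z hz w hw u hu hza.symm huw.symm h1.symm haa h3.symm hza' hzq'
        exact hM v q A hvA hA' hq a ha a' ha' w hw u hu haa huw.symm h1.symm (Ne.symm hu1) h2.symm (Ne.symm hu2)
          haq
      have := hS w (hAS hw) u (hAS hu) huw.symm
      tauto
    obtain ⟨w, hw⟩ : (A \ {a, a', z}).Nonempty := by
      rw [← Finset.card_pos]
      have := Finset.le_card_sdiff {a, a', z} A
      have : ({a, a', z} : Finset V).card ≤ 3 := Finset.card_le_three
      omega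
    obtain ⟨u, hu, u', hu', huu⟩ : ∃ u ∈ A \ {a, a', z, w}, ∃ u' ∈ A \ {a, a', z, w}, u ≠ u' := by
      apply Finset.one_lt_card.1
      have := Finset.le_card_sdiff {a, a', z, w} A
      have : ({a, a', z, w} : Finset V).card ≤ 4 := Finset.card_le_four
      omega
    have hw' := out w (by grind) (by grind) (by grind) (by grind)
    have hcA := Finset.card_erase_of_mem (show w ∈ A by grind)
    exact hM w q' (A.erase w) (by simp) (by omega) (fun y hy => hw' y (by grind) (by grind))
      u (by grind) a (by grind) u' (by grind) a' (by grind) (by grind) (by grind) huu (by grind)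
      (by grind) haa (out u (by grind) (by grind) (by grind) (by grind) a ha (by grind))
      (out u' (by grind) (by grind) (by grind) (by grind) a' ha' (by grind))

theorem StarFree.card_lt_of_two_colors [DecidableEq C] (hs : ∀ u v, d u v = d v u) (hM : StarFree t d)
    (ht : 6 ≤ t) {S : Finset V} {K : Finset C} (hK : K.card = 2) (hS : ColoredIn d S K) :
    S.card < 2 * t := by
  obtain ⟨q, q', -, rfl⟩ := Finset.card_eq_two.1 hK
  have hS' : ∀ u ∈ S, ∀ v ∈ S, u ≠ v → d u v = q ∨ d u v = q' := fun u hu v hv huv => by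
    simpa using hS u hu v hv huv
  by_contra! hc
  obtain ⟨v, hv⟩ : S.Nonempty := Finset.card_pos.1 (by omega)
  have hcard := Finset.card_erase_of_mem hv
  have hsum := Finset.card_filter_add_card_filter_not (s := S.erase v) (fun z => d v z = q)
  refine absurd ?_ hc.not_gt
  by_cases hA : t ≤ ((S.erase v).filter fun z => d v z = q).card
  · exact hM.two_colors_aux hs ht hS' (v := v) (by simp)
      ((Finset.filter_subset _ _).trans (Finset.erase_subset _ _)) hA (by simp)
  · refine hM.two_colors_aux hs ht (q := q') (q' := q)
      (fun u hu v hv huv => (hS' u hu v hv huv).symm) (v := v)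
      (A := (S.erase v).filter fun z => ¬ d v z = q) (by simp)
      ((Finset.filter_subset _ _).trans (Finset.erase_subset _ _)) (by omega) ?_
    intro z hz
    simp only [Finset.mem_filter, Finset.mem_erase] at hz
    have := hS' v hv z hz.1.2 hz.1.1.symm
    tauto


/-- In a Gallai partition `p` on colors `r`, `b` with every part small, no vertex has a huge
neighborhood outside its part. -/
theorem StarFree.card_le_of_small_parts (hM : StarFree t d) (ht : 6 ≤ t) {S R : Finset V}
    {p : V → V} {r b : C} (hrb : ∀ u ∈ S, ∀ v ∈ S, p u ≠ p v → d u v = r ∨ d u v = b)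
    (hsmall : ∀ w ∈ S, (S.filter fun z => p z = p w).card + 2 ≤ t) (hRS : R ⊆ S) {v : V}
    (hvR : v ∉ R) (hv : ∀ z ∈ R, d v z = r) : R.card ≤ 2 * t := by
  by_contra! hc
  obtain ⟨D, -, hD, hF⟩ := hM.exists_cover hvR (by omega) hv
  have h1 := Finset.le_card_sdiff D R
  obtain ⟨w, hw⟩ : (R \ D).Nonempty := Finset.card_pos.1 (by omega)
  have hwS : w ∈ S := hRS (Finset.mem_sdiff.1 hw).1
  have h2 := hsmall w hwS
  have h3 := Finset.le_card_sdiff (S.filter fun z => p z = p w) (R \ D)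
  set N := (R \ D) \ S.filter fun z => p z = p w with hN
  have hNR : ∀ z ∈ N, z ∈ R \ D ∧ z ∈ S ∧ p w ≠ p z := by
    intro z hz
    rw [hN, Finset.mem_sdiff, Finset.mem_filter] at hz
    have hzS := hRS (Finset.mem_sdiff.1 hz.1).1
    exact ⟨hz.1, hzS, fun h => hz.2 ⟨hzS, h.symm⟩⟩
  have hwb : ∀ z ∈ N, d w z = b := by
    intro z hz
    obtain ⟨hz1, hz2, hz3⟩ := hNR z hz
    exact (hrb w hwS z hz2 hz3).resolve_left (hF w hw z hz1 fun h => hz3 (congrArg p h))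
  obtain ⟨E, -, hE, hG⟩ := hM.exists_cover (fun h => (hNR w h).2.2 rfl) (by omega) hwb
  have h4 := Finset.le_card_sdiff E N
  obtain ⟨x, hx⟩ : (N \ E).Nonempty := Finset.card_pos.1 (by omega)
  have hxN := hNR x (Finset.mem_sdiff.1 hx).1
  have h5 := hsmall x hxN.2.1
  have h6 : N \ E ⊆ S.filter fun z => p z = p x := by
    intro z hz
    have hzN := hNR z (Finset.mem_sdiff.1 hz).1
    refine Finset.mem_filter.2 ⟨hzN.2.1, ?_⟩
    by_contra hne
    have hzx : z ≠ x := fun h => hne (congrArg p h)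
    rcases hrb z hzN.2.1 x hxN.2.1 hne with h | h
    · exact hF z hzN.1 x hxN.1 hzx h
    · exact hG z hz x hx hzx h
  have := Finset.card_le_card h6
  omega

/-- A subset without the color `r` of a Gallai partition on colors `r`, `b`. -/
theorem StarFree.card_lt_of_colorFree (hs : ∀ u v, d u v = d v u) (hM : StarFree t d)
    (ht : 6 ≤ t) {S R : Finset V} {p : V → V} {r b : C}
    (hrb : ∀ u ∈ S, ∀ v ∈ S, p u ≠ p v → d u v = r ∨ d u v = b)
    (hp : ∀ u ∈ S, ∀ u' ∈ S, ∀ v ∈ S, p u = p u' → p u ≠ p v → d u v = d u' v)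
    (hb : ∀ w ∈ S, ∃ z ∈ S, p w ≠ p z ∧ d w z = b) (hRS : R ⊆ S) (hR : ColorFree d R r) {m : ℕ}
    (hm : t ≤ m) (hmR : ∀ T ⊆ R, ColorFree d T b → T.card < m) : R.card < 2 * m := by
  rcases R.eq_empty_or_nonempty with rfl | ⟨u, hu⟩
  · simp only [Finset.card_empty]
    omega
  by_cases hone : ∀ v ∈ R, p v = p u
  · obtain ⟨z, hz, hzu, hzb⟩ := hb u (hRS hu)
    have hzR : ∀ v ∈ R, d z v = b := fun v hv => by
      rw [hs, ← hzb]
      exact hp v (hRS hv) u (hRS hu) z hz (hone v hv) (by rwa [hone v hv])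
    by_cases hRt : t ≤ R.card + 1
    · obtain ⟨D, -, hD, hF⟩ := hM.exists_cover (fun h => hzu (hone z h).symm) hRt hzR
      have := hmR _ Finset.sdiff_subset hF
      have := Finset.le_card_sdiff D R
      omega
    · omega
  · push Not at hone
    obtain ⟨v, hv, hvu⟩ := hone
    rw [← Finset.card_filter_add_card_filter_not (s := R) (fun z => p z = p u)]
    refine hM.card_add_card_lt hs ht (q := b) (Finset.disjoint_filter_filter_not _ _ _)
      ⟨u, by simp [hu]⟩ ⟨v, by simp [hv, hvu]⟩ ?_ hm
      (fun T hT => hmR T (hT.trans (Finset.filter_subset _ _)))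
      (fun T hT => hmR T (hT.trans (Finset.filter_subset _ _)))
    intro x hx y hy
    rw [Finset.mem_filter] at hx hy
    have hxy : p x ≠ p y := fun h => hy.2 (h.symm.trans hx.2)
    exact (hrb x (hRS hx.1) y (hRS hy.1) hxy).resolve_left
      (hR x hx.1 y hy.1 fun h => hxy (congrArg p h))

/-- The `r`-neighborhood `R` of a large part `H` of a Gallai partition on colors `r`, `b`. -/
theorem StarFree.exists_cover_part (hs : ∀ u v, d u v = d v u) (hM : StarFree t d)
    (ht : 6 ≤ t) {S H R : Finset V} {p : V → V} {r b : C}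
    (hrb : ∀ u ∈ S, ∀ v ∈ S, p u ≠ p v → d u v = r ∨ d u v = b)
    (hp : ∀ u ∈ S, ∀ u' ∈ S, ∀ v ∈ S, p u = p u' → p u ≠ p v → d u v = d u' v)
    (hb : ∀ w ∈ S, ∃ z ∈ S, p w ≠ p z ∧ d w z = b) (hRS : R ⊆ S) (hHR : Disjoint H R)
    (hne : R.Nonempty) (hj : JoinedBy d H R r) (hH : t ≤ H.card + 1) {m : ℕ} (hm : t ≤ m)
    (hmR : ∀ T ⊆ R, ColorFree d T r → ColorFree d T b → T.card < m) :
    ∃ D ⊆ H, ColorFree d (H \ D) r ∧ R.card + D.card ≤ 2 * m := by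
  by_cases hRt : t ≤ R.card + 1
  · obtain ⟨D, hD, hFH, hFR⟩ := hM.exists_cover_joined hs ht hHR hH hRt hj
    refine ⟨H ∩ D, Finset.inter_subset_left, by rwa [Finset.sdiff_inter_self_left], ?_⟩
    have h1 := hM.card_lt_of_colorFree hs ht hrb hp hb (Finset.sdiff_subset.trans hRS) hFR hm
      fun T hT => hmR T (hT.trans Finset.sdiff_subset) (hFR.mono hT)
    have h2 := Finset.card_sdiff_add_card_inter R D
    have h3 : (R ∩ D).card + (H ∩ D).card ≤ D.card := by
      rw [← Finset.card_union_of_disjoint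
        (hHR.symm.mono Finset.inter_subset_left Finset.inter_subset_left)]
      exact Finset.card_le_card (Finset.union_subset Finset.inter_subset_right
        Finset.inter_subset_right)
    omega
  · obtain ⟨y, hy⟩ := hne
    obtain ⟨D, hDH, hD, hF⟩ := hM.exists_cover (v := y) (X := H) (q := r)
      (fun h => Finset.disjoint_left.1 hHR h hy) hH (fun z hz => (hs y z).trans (hj z hz y hy))
    exact ⟨D, hDH, hF, by omega⟩

/-- A coloring without monochromatic `S_t^2` is `StarFree`. -/
theorem starFree_of_not_hasMonoCopy (ht : 6 ≤ t) {c : Sym2 V → C}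
    (h : ¬ HasMonoCopy (SGraph t 2) c) : StarFree t fun u v => c s(u, v) := by
  intro v q N hv hN hvq a ha b hb x hx y hy hab hxy hax hay hbx hby habq hxyq
  refine h ?_
  let l : List V := v :: a :: b :: x :: y :: (N \ {a, b, x, y}).toList
  have hmem : ∀ z ∈ l, z ≠ v → z ∈ N := by
    intro z hz hzv
    simp only [l, List.mem_cons, Finset.mem_toList, Finset.mem_sdiff] at hz
    grind
  have hl : l.Nodup := by
    simp only [l, List.nodup_cons, List.mem_cons, Finset.mem_toList, Finset.nodup_toList,
      Finset.mem_sdiff, Finset.mem_insert, Finset.mem_singleton]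
    grind
  have hlen : t ≤ l.length := by
    simp only [l, List.length_cons, Finset.length_toList]
    have := Finset.le_card_sdiff {a, b, x, y} N
    have : ({a, b, x, y} : Finset V).card ≤ 4 := Finset.card_le_four
    omega
  let f : Fin t ↪ V := ⟨fun i => l[i.val], fun i j hij =>
    Fin.ext ((List.Nodup.getElem_inj_iff hl).1 hij)⟩
  have key : ∀ i j : Fin t, i ≠ j →
      (i.val = 0 ∨ (j.val = i.val + 1 ∧ i.val % 2 = 1 ∧ j.val ≤ 2 * 2)) →
      c s(f i, f j) = q := by
    rintro ⟨i, hi⟩ ⟨j, hj⟩ hij hcase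
    simp only [ne_eq, Fin.mk.injEq] at hij
    rcases hcase with h0 | ⟨h1, h2, h3⟩
    · simp only at h0
      subst h0
      refine hvq _ (hmem _ (List.getElem_mem _) fun e => ?_)
      exact hij ((List.Nodup.getElem_inj_iff hl).1 (show l[0] = l[j] from e.symm))
    · simp only at h1 h2 h3
      have : i = 1 ∨ i = 3 := by omega
      rcases this with rfl | rfl
      · subst h1
        exact habq
      · subst h1
        exact hxyq
  refine ⟨f, q, fun i j hij => ?_⟩
  rw [SGraph, SimpleGraph.fromRel_adj] at hij
  rcases hij.2 with h | h
  · exact key i j hij.1 h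
  · rw [Sym2.eq_swap]
    exact key j i hij.1.symm h

variable [DecidableEq C]

theorem StarFree.card_lt_step (hs : ∀ u v, d u v = d v u) (hr : GallaiColoring d)
    (hM : StarFree t d) (ht : 6 ≤ t) {k m m' : ℕ} (hm : t ≤ m) (hm' : t ≤ m')
    (hmm : 2 * m' ≤ 5 * m)
    (h1 : ∀ (K : Finset C) (S : Finset V), K.card = k → ColoredIn d S K → S.card < m)
    (h2 : ∀ (K : Finset C) (S : Finset V), K.card = k + 1 → ColoredIn d S K → S.card < m')
    {K : Finset C} {S : Finset V} (hK : K.card = k + 2) (hS : ColoredIn d S K) :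
    S.card < 5 * m := by
  by_contra! hc
  obtain ⟨p, r, b, ⟨u₀, hu₀, v₀, hv₀, huv₀⟩, hrb, hp⟩ := hr.exists_partition hs S (by omega)
  have other : ∀ w ∈ S, ∃ z ∈ S, p w ≠ p z := by
    intro w hw
    by_cases h : p w = p u₀
    · exact ⟨v₀, hv₀, by rwa [h]⟩
    · exact ⟨u₀, hu₀, h⟩
  have mem : ∀ w ∈ S, ∀ z ∈ S, p w ≠ p z → d w z ∈ K := fun w hw z hz h =>
    hS w hw z hz fun e => h (congrArg p e)
  have two : ∀ w ∈ S, ∀ q, ∃ z ∈ S, p w ≠ p z ∧ d w z ≠ q := by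
    intro w hw q
    by_contra! hcon
    obtain ⟨z, hz, hwz⟩ := other w hw
    have hqK : q ∈ K := hcon z hz hwz ▸ mem w hw z hz hwz
    have hbd : ∀ T ⊆ S, ColorFree d T q → T.card < m' := fun T hT hF =>
      h2 (K.erase q) T (by rw [Finset.card_erase_of_mem hqK]; omega) ((hS.mono hT).erase hF)
    have := hM.card_add_card_lt hs ht (q := q)
      (Finset.disjoint_filter_filter_not S S fun z => p z = p w)
      ⟨w, by simp [hw]⟩ ⟨z, by simp [hz, hwz.symm]⟩ ?_ hm'
      (fun T hT => hbd T (hT.trans (Finset.filter_subset _ _)))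
      (fun T hT => hbd T (hT.trans (Finset.filter_subset _ _)))
    · rw [Finset.card_filter_add_card_filter_not] at this
      omega
    · intro x hx y hy
      rw [Finset.mem_filter] at hx hy
      rw [hp x hx.1 w hw y hy.1 hx.2 fun h => hy.2 (h.symm.trans hx.2)]
      exact hcon y hy.1 (Ne.symm hy.2)
  have hr' : ∀ w ∈ S, ∃ z ∈ S, p w ≠ p z ∧ d w z = r := fun w hw => by
    obtain ⟨z, hz, hwz, hne⟩ := two w hw b
    exact ⟨z, hz, hwz, (hrb w hw z hz hwz).resolve_right hne⟩
  have hb' : ∀ w ∈ S, ∃ z ∈ S, p w ≠ p z ∧ d w z = b := fun w hw => by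
    obtain ⟨z, hz, hwz, hne⟩ := two w hw r
    exact ⟨z, hz, hwz, (hrb w hw z hz hwz).resolve_left hne⟩
  have hne : b ≠ r := by
    rintro rfl
    obtain ⟨z, hz, hwz, h⟩ := two u₀ hu₀ b
    exact h ((hrb _ hu₀ z hz hwz).elim id id)
  have hrK : r ∈ K := by
    obtain ⟨z, hz, hwz, h⟩ := hr' u₀ hu₀
    exact h ▸ mem _ hu₀ z hz hwz
  have hbK : b ∈ K := by
    obtain ⟨z, hz, hwz, h⟩ := hb' u₀ hu₀
    exact h ▸ mem _ hu₀ z hz hwz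
  have hbd : ∀ T ⊆ S, ColorFree d T r → ColorFree d T b → T.card < m := by
    intro T hT hFr hFb
    refine h1 ((K.erase r).erase b) T ?_ (((hS.mono hT).erase hFr).erase hFb)
    rw [Finset.card_erase_of_mem (Finset.mem_erase.2 ⟨hne, hbK⟩), Finset.card_erase_of_mem hrK]
    omega
  have hbr : ∀ u ∈ S, ∀ v ∈ S, p u ≠ p v → d u v = b ∨ d u v = r :=
    fun u hu v hv h => (hrb u hu v hv h).symm
  have parts : ∀ w ∈ S, S.card ≤ (S.filter fun z => p z = p w).card +
      (S.filter fun z => p w ≠ p z ∧ d w z = r).card +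
      (S.filter fun z => p w ≠ p z ∧ d w z = b).card := by
    intro w hw
    refine le_trans (Finset.card_le_card ?_) ((Finset.card_union_le _ _).trans
      (Nat.add_le_add_right (Finset.card_union_le _ _) _))
    intro z hz
    simp only [Finset.mem_union, Finset.mem_filter, hz, true_and]
    by_cases h : p z = p w
    · exact .inl (.inl h)
    · rcases hrb w hw z hz (Ne.symm h) with e | e
      · exact .inl (.inr ⟨Ne.symm h, e⟩)
      · exact .inr ⟨Ne.symm h, e⟩
  by_cases hsmall : ∀ w ∈ S, (S.filter fun z => p z = p w).card + 2 ≤ t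
  · have e1 := hM.card_le_of_small_parts ht hrb hsmall (v := u₀)
      (R := S.filter fun z => p u₀ ≠ p z ∧ d u₀ z = r) (Finset.filter_subset _ _) (by simp)
      (by simp +contextual)
    have e2 := hM.card_le_of_small_parts ht hbr hsmall (v := u₀)
      (R := S.filter fun z => p u₀ ≠ p z ∧ d u₀ z = b) (Finset.filter_subset _ _) (by simp)
      (by simp +contextual)
    have e3 := hsmall u₀ hu₀
    have e4 := parts u₀ hu₀
    omega
  · push Not at hsmall
    obtain ⟨w, hw, hwt⟩ := hsmall
    have hdisj : ∀ q, Disjoint (S.filter fun z => p z = p w)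
        (S.filter fun z => p w ≠ p z ∧ d w z = q) := fun q =>
      Finset.disjoint_filter.2 fun z _ h h' => h'.1 h.symm
    have hjoin : ∀ q, JoinedBy d (S.filter fun z => p z = p w)
        (S.filter fun z => p w ≠ p z ∧ d w z = q) q := by
      intro q x hx y hy
      rw [Finset.mem_filter] at hx hy
      rw [hp x hx.1 w hw y hy.1 hx.2 (by rw [hx.2]; exact hy.2.1)]
      exact hy.2.2
    obtain ⟨D, hDH, hDF, hDc⟩ := hM.exists_cover_part hs ht hrb hp hb' (Finset.filter_subset _ _)
      (hdisj r) (by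
        obtain ⟨z, hz, h⟩ := hr' w hw
        exact ⟨z, Finset.mem_filter.2 ⟨hz, h⟩⟩) (hjoin r) (by omega) hm
      (fun T hT => hbd T (hT.trans (Finset.filter_subset _ _)))
    obtain ⟨E, hEH, hEF, hEc⟩ := hM.exists_cover_part hs ht hbr hp hr' (Finset.filter_subset _ _)
      (hdisj b) (by
        obtain ⟨z, hz, h⟩ := hb' w hw
        exact ⟨z, Finset.mem_filter.2 ⟨hz, h⟩⟩) (hjoin b) (by omega) hm
      (fun T hT h h' => hbd T (hT.trans (Finset.filter_subset _ _)) h' h)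
    have e1 := hbd ((S.filter fun z => p z = p w) \ (D ∪ E))
      (Finset.sdiff_subset.trans (Finset.filter_subset _ _))
      (hDF.mono (Finset.sdiff_subset_sdiff le_rfl Finset.subset_union_left))
      (hEF.mono (Finset.sdiff_subset_sdiff le_rfl Finset.subset_union_right))
    have e2 := Finset.le_card_sdiff (D ∪ E) (S.filter fun z => p z = p w)
    have e3 := Finset.card_union_le D E
    have e4 := parts w hw
    omega

/-- The upper bound on the Gallai-Ramsey number of `S_t^2` for `i + 1` colors. -/
def upperBound (t : ℕ) : ℕ → ℕ
  | 0 => t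
  | 1 => 2 * t
  | i + 2 => 5 * upperBound t i

theorem le_upperBound (t : ℕ) : ∀ i, t ≤ upperBound t i
  | 0 => le_rfl
  | 1 => by simp only [upperBound]; omega
  | i + 2 => by
    have := le_upperBound t i
    simp only [upperBound]
    omega

theorem two_mul_upperBound_le (t : ℕ) : ∀ i, 2 * upperBound t (i + 1) ≤ 5 * upperBound t i
  | 0 => by simp only [upperBound]; omega
  | 1 => by simp only [upperBound]; omega
  | i + 2 => by
    have := two_mul_upperBound_le t i
    simp only [upperBound]
    omega

theorem StarFree.card_lt_upperBound (hs : ∀ u v, d u v = d v u) (hr : GallaiColoring d)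
    (hM : StarFree t d) (ht : 6 ≤ t) : ∀ (i : ℕ) (K : Finset C) (S : Finset V),
    K.card = i + 1 → ColoredIn d S K → S.card < upperBound t i
  | 0, K, S, hK, hS => by
    obtain ⟨q, rfl⟩ := Finset.card_eq_one.1 hK
    exact hM.clique_card_lt ht hS
  | 1, K, S, hK, hS => hM.card_lt_of_two_colors hs ht hK hS
  | i + 2, K, S, hK, hS =>
    hM.card_lt_step hs hr ht (le_upperBound t i) (le_upperBound t (i + 1))
      (two_mul_upperBound_le t i) (hM.card_lt_upperBound hs hr ht i)
      (hM.card_lt_upperBound hs hr ht (i + 1)) hK hS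

theorem hasRainbowTriangle_or_hasMonoCopy [Fintype V] [Fintype C] (ht : 6 ≤ t) {i : ℕ}
    (hC : Fintype.card C = i + 1) (hV : upperBound t i ≤ Fintype.card V) (c : Sym2 V → C) :
    HasRainbowTriangle c ∨ HasMonoCopy (SGraph t 2) c := by
  by_contra! hc
  obtain ⟨hr, hM⟩ := hc
  have hr' : GallaiColoring fun u v => c s(u, v) := by
    intro x y z
    by_contra! h
    exact hr ⟨x, y, z, h⟩
  have := (starFree_of_not_hasMonoCopy ht hM).card_lt_upperBound (fun u v => by rw [Sym2.eq_swap])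
    hr' ht i Finset.univ Finset.univ (by rw [Finset.card_univ, hC]) fun _ _ _ _ _ =>
      Finset.mem_univ _
  rw [Finset.card_univ] at this
  omega

end Upper

section Lower

variable {V W : Type*} {t k j : ℕ}

/-- A symmetric coloring with `k` colors and neither rainbow triangles nor monochromatic `S_t^2`. -/
structure AvoidingColoring (t k : ℕ) (V : Type*) where
  /-- The color of a pair of vertices. -/
  color : V → V → ℕ
  symm : ∀ u v, color u v = color v u
  lt : ∀ u v, color u v < k
  gallai : GallaiColoring color
  avoids : ∀ (f : Fin t ↪ V) (q : ℕ), ∃ x y, (SGraph t 2).Adj x y ∧ color (f x) (f y) ≠ q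

/-- A symmetric coloring with `j` colors and neither rainbow nor monochromatic triangles. -/
structure TriangleColoring (j : ℕ) (W : Type*) where
  /-- The color of a pair of vertices. -/
  color : W → W → ℕ
  symm : ∀ u v, color u v = color v u
  lt : ∀ u v, color u v < j
  gallai : GallaiColoring color
  avoids : ∀ x y z, x ≠ y → y ≠ z → x ≠ z → color x y = color y z → color x y ≠ color x z

/-- Replace every vertex of `W` by a copy of `V`. -/
def AvoidingColoring.blowup [DecidableEq W] (A : AvoidingColoring t k V)
    (B : TriangleColoring j W) (ht : 6 ≤ t) : AvoidingColoring t (k + j) (V × W) where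
  color u v := if u.2 = v.2 then A.color u.1 v.1 else k + B.color u.2 v.2
  symm u v := by
    simp only [A.symm u.1 v.1, B.symm u.2 v.2, eq_comm (a := u.2)]
  lt u v := by
    have := A.lt u.1 v.1
    have := B.lt u.2 v.2
    split_ifs <;> omega
  gallai := by
    rintro ⟨u, x⟩ ⟨v, y⟩ ⟨w, z⟩
    have h1 := A.gallai u v w
    have h2 := B.gallai x y z
    simp only
    by_cases hxy : x = y
    · subst hxy
      by_cases hxz : x = z
      · subst hxz
        simpa using h1
      · simp [hxz]
    · by_cases hyz : y = z
      · subst hyz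
        simp [hxy]
      · by_cases hxz : x = z
        · subst hxz
          simp [hxy, hyz, B.symm x y]
        · simpa [hxy, hyz, hxz] using h2
  avoids f q := by
    by_contra! hc
    have hadj : ∀ x y : Fin t, x ≠ y →
        (x.val = 0 ∨ (y.val = x.val + 1 ∧ x.val % 2 = 1 ∧ y.val ≤ 2 * 2)) →
        (SGraph t 2).Adj x y := fun x y hxy h => by
      rw [SGraph, SimpleGraph.fromRel_adj]
      exact ⟨hxy, .inl h⟩
    by_cases hq : q < k
    · have hfib : ∀ x, (f x).2 = (f ⟨0, by omega⟩).2 := by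
        intro x
        by_cases hx : ⟨0, by omega⟩ = x
        · rw [hx]
        · have := hc _ x (hadj _ x hx (.inl rfl))
          split_ifs at this with h
          · exact h.symm
          · omega
      obtain ⟨x, y, hxy, hne⟩ := A.avoids ⟨fun x => (f x).1, fun x y h =>
        f.injective (Prod.ext h ((hfib x).trans (hfib y).symm))⟩ q
      have := hc x y hxy
      rw [if_pos ((hfib x).trans (hfib y).symm)] at this
      exact hne this
    · have hcol : ∀ x y, (SGraph t 2).Adj x y →
          (f x).2 ≠ (f y).2 ∧ k + B.color (f x).2 (f y).2 = q := by
        intro x y hxy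
        have h1 := hc x y hxy
        have h2 := A.lt (f x).1 (f y).1
        split_ifs at h1 with h
        · omega
        · exact ⟨h, h1⟩
      have e1 := hcol ⟨0, by omega⟩ ⟨1, by omega⟩ (hadj _ _ (by simp) (.inl rfl))
      have e2 := hcol ⟨1, by omega⟩ ⟨2, by omega⟩ (hadj _ _ (by simp) (.inr (by simp)))
      have e3 := hcol ⟨0, by omega⟩ ⟨2, by omega⟩ (hadj _ _ (by simp) (.inl rfl))
      exact B.avoids _ _ _ e1.1 e2.1 e3.1 (by omega) (by omega)

/-- The single edge. -/
def TriangleColoring.edge : TriangleColoring 1 Bool where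
  color _ _ := 0
  symm _ _ := rfl
  lt _ _ := Nat.one_pos
  gallai _ _ _ := .inl rfl
  avoids := by decide

/-- The coloring of `K_5` by two 5-cycles. -/
def TriangleColoring.pentagon : TriangleColoring 2 (Fin 5) where
  color x y := if x = y + 1 ∨ y = x + 1 then 0 else 1
  symm := by decide
  lt := by decide
  gallai := by
    unfold GallaiColoring
    decide
  avoids := by decide

/-- A single color on too few vertices. -/
def AvoidingColoring.const (ht : 6 ≤ t) : AvoidingColoring t 1 (Fin (t - 1)) where
  color _ _ := 0
  symm _ _ := rfl
  lt _ _ := Nat.one_pos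
  gallai _ _ _ := .inl rfl
  avoids f _ := by
    have := Fintype.card_le_of_embedding f
    simp only [Fintype.card_fin] at this
    omega

theorem AvoidingColoring.exists_pentagon_blowup (ht : 6 ≤ t) {V : Type} [Fintype V]
    (A : AvoidingColoring t k V) (j : ℕ) : ∃ (W : Type) (_ : Fintype W),
      Fintype.card W = Fintype.card V * 5 ^ j ∧ Nonempty (AvoidingColoring t (k + 2 * j) W) := by
  induction j with
  | zero => exact ⟨V, inferInstance, by simp, ⟨A⟩⟩
  | succ j ih =>
    obtain ⟨W, _, hW, ⟨B⟩⟩ := ih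
    refine ⟨W × Fin 5, inferInstance, ?_, ⟨B.blowup .pentagon ht⟩⟩
    rw [Fintype.card_prod, hW, Fintype.card_fin, pow_succ, mul_assoc]

theorem AvoidingColoring.card_lt {V : Type*} [Fintype V] (A : AvoidingColoring t k V) {n : ℕ}
    (hn : ∀ c : Sym2 (Fin n) → Fin k, HasRainbowTriangle c ∨ HasMonoCopy (SGraph t 2) c) :
    Fintype.card V < n := by
  by_contra! hc
  obtain ⟨g⟩ := Function.Embedding.nonempty_of_card_le
    (show Fintype.card (Fin n) ≤ Fintype.card V by simpa using hc)
  rcases hn (Sym2.lift ⟨fun x y => ⟨A.color (g x) (g y), A.lt _ _⟩, fun x y =>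
    Fin.ext (A.symm _ _)⟩) with ⟨x, y, z, h1, h2, h3⟩ | ⟨f, q, hf⟩
  · simp only [Sym2.lift_mk, ne_eq, Fin.mk.injEq] at h1 h2 h3
    have := A.gallai (g x) (g y) (g z)
    tauto
  · obtain ⟨x, y, hxy, hne⟩ := A.avoids (f.trans g) q
    exact hne (congrArg Fin.val (hf x y hxy))

end Lower

theorem upperBound_two_mul (t : ℕ) : ∀ j, upperBound t (2 * j) = t * 5 ^ j
  | 0 => by simp [upperBound]
  | j + 1 => by
    rw [mul_add, upperBound, upperBound_two_mul t j]
    ring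

theorem upperBound_two_mul_add_one (t : ℕ) : ∀ j, upperBound t (2 * j + 1) = 2 * t * 5 ^ j
  | 0 => by simp [upperBound]
  | j + 1 => by
    rw [show 2 * (j + 1) + 1 = 2 * j + 1 + 2 by ring, upperBound, upperBound_two_mul_add_one t j]
    ring

theorem gallai_ramsey_St2_bounds (k t : ℕ) (hk : 1 ≤ k) (ht : 6 ≤ t) :
    ∃ N : ℕ,
      IsLeast {n : ℕ | ∀ c : Sym2 (Fin n) → Fin k,
        HasRainbowTriangle c ∨ HasMonoCopy (SGraph t 2) c} N ∧
      (Even k → 2 * (t - 1) * 5 ^ ((k - 2) / 2) + 1 ≤ N ∧ N ≤ 2 * t * 5 ^ ((k - 2) / 2)) ∧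
      (Odd k → (t - 1) * 5 ^ ((k - 1) / 2) + 1 ≤ N ∧ N ≤ t * 5 ^ ((k - 1) / 2)) := by
  classical
  have hub : ∀ c : Sym2 (Fin (upperBound t (k - 1))) → Fin k,
      HasRainbowTriangle c ∨ HasMonoCopy (SGraph t 2) c := fun c =>
    hasRainbowTriangle_or_hasMonoCopy ht (i := k - 1) (by rw [Fintype.card_fin]; omega)
      (by rw [Fintype.card_fin]) c
  have hex : ∃ n : ℕ, ∀ c : Sym2 (Fin n) → Fin k,
      HasRainbowTriangle c ∨ HasMonoCopy (SGraph t 2) c := ⟨_, hub⟩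
  have hle := Nat.find_min' hex hub
  refine ⟨Nat.find hex, ⟨Nat.find_spec hex, fun n hn => Nat.find_min' hex hn⟩, ?_, ?_⟩
  · rintro ⟨m, hm⟩
    obtain ⟨j, rfl⟩ : ∃ j, k = 2 + 2 * j := ⟨m - 1, by omega⟩
    rw [show 2 + 2 * j - 1 = 2 * j + 1 by omega, upperBound_two_mul_add_one] at hle
    rw [show (2 + 2 * j - 2) / 2 = j by omega]
    obtain ⟨W, _, hW, ⟨A⟩⟩ :=
      ((AvoidingColoring.const ht).blowup .edge ht).exists_pentagon_blowup ht j
    have hlt := A.card_lt (Nat.find_spec hex)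
    rw [hW, Fintype.card_prod, Fintype.card_fin, Fintype.card_bool, mul_comm (t - 1)] at hlt
    exact ⟨hlt, hle⟩
  · rintro ⟨j, rfl⟩
    rw [show 2 * j + 1 - 1 = 2 * j by omega, upperBound_two_mul] at hle
    rw [show (2 * j + 1 - 1) / 2 = j by omega]
    obtain ⟨W, _, hW, ⟨A⟩⟩ := (AvoidingColoring.const ht).exists_pentagon_blowup ht j
    rw [add_comm] at A
    have hlt := A.card_lt (Nat.find_spec hex)
    rw [hW, Fintype.card_fin] at hlt
    exact ⟨hlt, hle⟩
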